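/- The iterates c_{n+1} = γ̄(c_n) with γ̄(c) = (16c+1)/(16(12c+1)) and any starting value c_0 ≥ 0 converge to √3/24, with |c_n − √3/24| ≤ (1/4)^n |c_0 − √3/24|. -/

import Mathlib

/-- The Möbius map `x ↦ (16x+1)/(16(12x+1))` contracts distances on `[0,∞)` by a factor `1/4`. -/
lemma abs_mobius_sub_le {x y : ℝ} (hx : 0 ≤ x) (hy : 0 ≤ y) :
    |(16 * x + 1) / (16 * (12 * x + 1)) - (16 * y + 1) / (16 * (12 * y + 1))| ≤
      1 / 4 * |x - y| := by
  have h : (16 * x + 1) / (16 * (12 * x + 1)) - (16 * y + 1) / (16 * (12 * y + 1)) =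
      (1 / 4 * (x - y)) / ((12 * x + 1) * (12 * y + 1)) := by
    have : 12 * x + 1 ≠ 0 := by positivity
    have : 12 * y + 1 ≠ 0 := by positivity
    field_simp
    ring
  have hden : 1 ≤ (12 * x + 1) * (12 * y + 1) := by nlinarith [mul_nonneg hx hy]
  rw [h, abs_div, abs_of_pos (zero_lt_one.trans_le hden), abs_mul,
    abs_of_pos (by norm_num : (0 : ℝ) < 1 / 4)]
  exact div_le_self (by positivity) hden

lemma mobius_sqrt_three_div :
    (16 * (Real.sqrt 3 / 24) + 1) / (16 * (12 * (Real.sqrt 3 / 24) + 1)) =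
      Real.sqrt 3 / 24 := by
  have hsq : Real.sqrt 3 ^ 2 = 3 := Real.sq_sqrt (by norm_num)
  rw [div_eq_iff (by positivity)]
  linear_combination (-1 / 3 : ℝ) * hsq

/-- The iterates c_{n+1} = γ̄(c_n) with c_0 ≥ 0 converge to √3/24, with
|c_n − √3/24| ≤ (1/4)^n |c_0 − √3/24|. -/
theorem gamma_iterates_converge (γ : ℝ → ℝ)
    (hγ : ∀ c : ℝ, γ c = (16 * c + 1) / (16 * (12 * c + 1)))
    (c : ℕ → ℝ) (h0 : 0 ≤ c 0) (hrec : ∀ n : ℕ, c (n + 1) = γ (c n)) :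
    (∀ n : ℕ, |c n - Real.sqrt 3 / 24| ≤ (1 / 4 : ℝ) ^ n * |c 0 - Real.sqrt 3 / 24|) ∧
    Filter.Tendsto c Filter.atTop (nhds (Real.sqrt 3 / 24)) := by
  have hnonneg : ∀ n, 0 ≤ c n := by
    intro n
    induction n with
    | zero => exact h0
    | succ n ih =>
      rw [hrec, hγ]
      positivity
  have hbound : ∀ n : ℕ,
      |c n - Real.sqrt 3 / 24| ≤ (1 / 4 : ℝ) ^ n * |c 0 - Real.sqrt 3 / 24| := by
    intro n
    induction n with
    | zero => simp
    | succ n ih =>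
      have hstep := abs_mobius_sub_le (hnonneg n) (by positivity : 0 ≤ Real.sqrt 3 / 24)
      rw [mobius_sqrt_three_div, ← hγ, ← hrec] at hstep
      rw [pow_succ']
      linarith
  refine ⟨hbound, tendsto_iff_dist_tendsto_zero.2 ?_⟩
  have hgeom : Filter.Tendsto (fun n : ℕ => (1 / 4 : ℝ) ^ n * |c 0 - Real.sqrt 3 / 24|)
      Filter.atTop (nhds 0) := by
    simpa using (tendsto_pow_atTop_nhds_zero_of_lt_one (by norm_num : (0 : ℝ) ≤ 1 / 4)
      (by norm_num)).mul_const |c 0 - Real.sqrt 3 / 24|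
  exact squeeze_zero (fun _ => dist_nonneg) hbound hgeom
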